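/- Let u₀ ∈ C(ℍ) be uniformly h-quasiconvex in ℍ with parameters r₀ > 0 and λ > 0, and assume there exists L > 0 with u₀(p) ≤ L(|p|_G⁴ + 1) for all p ∈ ℍ. Let u_ε be the game value with terminal cost u₀ and step size ε > 0, and for t > 0 let U^t(p) = lim_{r→0} sup{u_ε(q,t) : q ∈ B_r(p), 0 < ε < r} be the relaxed upper limit of u_ε(·,t) as ε → 0. Then for each fixed t > 0: U^t is upper semicontinuous and locally bounded on ℍ, U^t is a viscosity subsolution of overline{L[U^t]} ≥ 2λ in ℍ (i.e., whenever U^t − φ attains a strict local maximum at p̂ for smooth φ, overline{L[φ]}(p̂) ≥ 2λ), and U^t is h-quasiconvex in ℍ. -/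

import Mathlib

open Filter Topology

noncomputable section

abbrev Heis := ℝ × ℝ × ℝ

def hMul (p q : Heis) : Heis :=
  (p.1 + q.1, p.2.1 + q.2.1, p.2.2 + q.2.2 + (p.1 * q.2.1 - q.1 * p.2.1) / 2)

def horiz : Set Heis := {h : Heis | h.2.2 = 0}

def hPlane (p : Heis) : Set Heis := {q : Heis | ∃ h ∈ horiz, q = hMul p h}

def hSeg (p q : Heis) : Set Heis :=
  {w : Heis | ∃ l : ℝ, 0 ≤ l ∧ l ≤ 1 ∧ w = l • p + (1 - l) • q}

def HConvex (E : Set Heis) : Prop :=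
  ∀ p ∈ E, ∀ q ∈ E, q ∈ hPlane p → hSeg p q ⊆ E

def HQuasiconvexOn (f : Heis → ℝ) (Ω : Set Heis) : Prop :=
  ∀ p ∈ Ω, ∀ q ∈ Ω, q ∈ hPlane p → ∀ w ∈ hSeg p q, f w ≤ max (f p) (f q)

def X1 (f : Heis → ℝ) (p : Heis) : ℝ :=
  fderiv ℝ f p (1, 0, 0) - p.2.1 / 2 * fderiv ℝ f p (0, 0, 1)

def X2 (f : Heis → ℝ) (p : Heis) : ℝ :=
  fderiv ℝ f p (0, 1, 0) + p.1 / 2 * fderiv ℝ f p (0, 0, 1)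

def gradH (f : Heis → ℝ) (p : Heis) : ℝ × ℝ := (X1 f p, X2 f p)

def hessH (f : Heis → ℝ) (p : Heis) : ℝ × ℝ × ℝ :=
  (X1 (X1 f) p, (X1 (X2 f) p + X2 (X1 f) p) / 2, X2 (X2 f) p)

def L0H (ξ : ℝ × ℝ) (A : ℝ × ℝ × ℝ) : ℝ :=
  sInf {m : ℝ | ∃ η : ℝ × ℝ, η.1 ^ 2 + η.2 ^ 2 = 1 ∧ ξ.1 * η.1 + ξ.2 * η.2 = 0 ∧
    m = A.1 * η.1 ^ 2 + 2 * A.2.1 * η.1 * η.2 + A.2.2 * η.2 ^ 2}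

def Lop (f : Heis → ℝ) (p : Heis) : ℝ := L0H (gradH f p) (hessH f p)

def LbarOp (f : Heis → ℝ) (p : Heis) : ℝ := limsup (Lop f) (𝓝 p)

def LstarOp (f : Heis → ℝ) (p : Heis) : ℝ :=
  limsup (fun q : (ℝ × ℝ) × ℝ × ℝ × ℝ => L0H q.1 q.2) (𝓝 (gradH f p, hessH f p))

def StrictLocalMaxOnSet (g : Heis → ℝ) (Ω : Set Heis) (p : Heis) : Prop :=
  ∃ U ∈ 𝓝 p, ∀ q ∈ U ∩ Ω, q ≠ p → g q < g p

def UniformlyHQuasiconvexOn (f : Heis → ℝ) (Ω : Set Heis) (r₀ lam : ℝ) : Prop :=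
  ∀ r : ℝ, 0 < r → r < r₀ → ∀ p ∈ Ω, ∀ v ∈ horiz, v.1 ^ 2 + v.2.1 ^ 2 = 1 →
    hMul p (r • v) ∈ Ω → hMul p (-(r • v)) ∈ Ω →
    f p ≤ max (f (hMul p (r • v))) (f (hMul p (-(r • v)))) - lam * r ^ 2

def gaugeK (p : Heis) : ℝ := ((p.1 ^ 2 + p.2.1 ^ 2) ^ 2 + 16 * p.2.2 ^ 2) ^ ((1 : ℝ) / 4)


/-- Relaxed upper limit of the family of game values `u ε (·, t)` as `ε → 0`:
`U^t(p) = lim_{r→0} sup {u ε q t : q ∈ B_r(p), 0 < ε < r}`. -/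
def relaxUpper (u : ℝ → Heis → ℝ → ℝ) (t : ℝ) (p : Heis) : ℝ :=
  ⨅ r : {r : ℝ // 0 < r}, sSup {a : ℝ | ∃ q : Heis, ∃ ε : ℝ,
    gaugeK (hMul (-p) q) < r.1 ∧ 0 < ε ∧ ε < r.1 ∧ a = u ε q t}

/-- The fourth power of the Korányi gauge. -/
def gauge4 (p : Heis) : ℝ := (p.1 ^ 2 + p.2.1 ^ 2) ^ 2 + 16 * p.2.2 ^ 2

lemma gauge4_nonneg (p : Heis) : 0 ≤ gauge4 p := by unfold gauge4; positivity

lemma gaugeK_nonneg (p : Heis) : 0 ≤ gaugeK p := Real.rpow_nonneg (gauge4_nonneg p) _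

lemma gaugeK_pow_four (p : Heis) : gaugeK p ^ 4 = gauge4 p := by
  have h := gauge4_nonneg p
  change (gauge4 p ^ ((1 : ℝ) / 4)) ^ 4 = gauge4 p
  rw [← Real.rpow_natCast, ← Real.rpow_mul h]
  norm_num

lemma continuous_gauge4 : Continuous gauge4 := by unfold gauge4; fun_prop

lemma continuous_gaugeK : Continuous gaugeK :=
  continuous_gauge4.rpow_const fun _ => Or.inr (by norm_num)

lemma continuous_hMul : Continuous fun x : Heis × Heis => hMul x.1 x.2 := by
  unfold hMul; fun_prop

lemma Continuous.hMul {α : Type*} [TopologicalSpace α] {f g : α → Heis} (hf : Continuous f)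
    (hg : Continuous g) : Continuous fun x => hMul (f x) (g x) :=
  continuous_hMul.comp (hf.prodMk hg)

lemma hMul_neg_cancel_left (p q : Heis) : hMul p (hMul (-p) q) = q := by
  simp only [hMul, Prod.fst_neg, Prod.snd_neg]
  ext
  · simp
  · simp
  · simp
    ring

lemma hMul_neg_self (p : Heis) : hMul (-p) p = 0 := by
  simp only [hMul, Prod.fst_neg, Prod.snd_neg]
  ext
  · simp
  · simp
  · simp [mul_comm]

lemma hMul_zero (p : Heis) : hMul p 0 = p := by simp [hMul]

lemma gaugeK_zero : gaugeK 0 = 0 := by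
  have h := gaugeK_pow_four 0
  simpa [gauge4] using h

/-- Moving twice along the same horizontal line. -/
lemma hMul_smul_smul (w v : Heis) (hv : v ∈ horiz) (a b : ℝ) :
    hMul (hMul w (a • v)) (b • v) = hMul w ((a + b) • v) := by
  have hv : v.2.2 = 0 := hv
  simp only [hMul, Prod.smul_fst, Prod.smul_snd, smul_eq_mul, hv]
  ext <;> simp <;> ring

/-- Small gauge means small in the product metric. -/
lemma norm_lt_of_gaugeK_lt {h : Heis} {r : ℝ} (hr : r ≤ 1) (hh : gaugeK h < r) : ‖h‖ < r := by
  have h0 := gaugeK_nonneg h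
  have hr0 : 0 < r := h0.trans_lt hh
  have h4 : gauge4 h < r ^ 4 := by
    rw [← gaugeK_pow_four]
    exact pow_lt_pow_left₀ hh h0 (by norm_num)
  unfold gauge4 at h4
  have hxy : h.1 ^ 2 + h.2.1 ^ 2 < r ^ 2 := by
    apply lt_of_pow_lt_pow_left₀ 2 (by positivity)
    nlinarith [sq_nonneg h.2.2]
  have hz : h.2.2 ^ 2 < r ^ 2 := by
    have : r ^ 4 ≤ r ^ 2 := pow_le_pow_of_le_one hr0.le hr (by norm_num)
    nlinarith [sq_nonneg (h.1 ^ 2 + h.2.1 ^ 2), sq_nonneg h.2.2]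
  have key : ∀ x : ℝ, x ^ 2 < r ^ 2 → ‖x‖ < r := fun x hx => abs_lt_of_sq_lt_sq hx hr0.le
  refine max_lt (key _ ?_) (max_lt (key _ ?_) (key _ hz))
  · nlinarith [sq_nonneg h.2.1]
  · nlinarith [sq_nonneg h.1]

/-- Gauge balls have bounded coordinates. -/
lemma gaugeK_ball_subset (r : ℝ) : ∃ C : ℝ, ∀ h : Heis, gaugeK h < r → ‖h‖ ≤ C := by
  refine ⟨1 + r ^ 4, fun h hh => ?_⟩
  have h0 := gaugeK_nonneg h
  have h4 : gauge4 h < r ^ 4 := by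
    rw [← gaugeK_pow_four]
    exact pow_lt_pow_left₀ hh h0 (by norm_num)
  unfold gauge4 at h4
  have key : ∀ x : ℝ, x ^ 2 ≤ 1 + r ^ 4 → ‖x‖ ≤ 1 + r ^ 4 := fun x hx => by
    rw [Real.norm_eq_abs]
    apply abs_le_of_sq_le_sq _ (by positivity)
    nlinarith [show 0 ≤ r ^ 4 by positivity]
  refine max_le (key _ ?_) (max_le (key _ ?_) (key _ ?_))
  · nlinarith [sq_nonneg h.2.1, sq_nonneg h.2.2, sq_nonneg (h.1 ^ 2 + h.2.1 ^ 2 - 1)]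
  · nlinarith [sq_nonneg h.1, sq_nonneg h.2.2, sq_nonneg (h.1 ^ 2 + h.2.1 ^ 2 - 1)]
  · nlinarith [sq_nonneg h.2.2, sq_nonneg (h.1 ^ 2 + h.2.1 ^ 2)]

/-- Every planar vector has a unit vector orthogonal to it. -/
lemma exists_unit_orthogonal (ξ : ℝ × ℝ) :
    ∃ η : ℝ × ℝ, η.1 ^ 2 + η.2 ^ 2 = 1 ∧ ξ.1 * η.1 + ξ.2 * η.2 = 0 := by
  by_cases h : ξ.1 ^ 2 + ξ.2 ^ 2 = 0
  · have h1 : ξ.1 = 0 := by nlinarith [sq_nonneg ξ.1, sq_nonneg ξ.2]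
    have h2 : ξ.2 = 0 := by nlinarith [sq_nonneg ξ.1, sq_nonneg ξ.2]
    exact ⟨(1, 0), by simp, by simp [h1, h2]⟩
  · have hp : 0 < ξ.1 ^ 2 + ξ.2 ^ 2 := lt_of_le_of_ne (by positivity) (Ne.symm h)
    have hs := Real.sq_sqrt hp.le
    have hs0 := Real.sqrt_pos.2 hp
    refine ⟨(-ξ.2 / √(ξ.1 ^ 2 + ξ.2 ^ 2), ξ.1 / √(ξ.1 ^ 2 + ξ.2 ^ 2)), ?_, ?_⟩
    · simp only [div_pow, hs]
      field_simp
      ring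
    · simp only
      field_simp
      ring

/-- Growth of the fourth power of the gauge along a direction orthogonal to its horizontal
gradient. -/
lemma gauge4_hMul_le (p : Heis) (a b s : ℝ) (hab : a ^ 2 + b ^ 2 = 1)
    (horth : (4 * p.1 * (p.1 ^ 2 + p.2.1 ^ 2) - 16 * p.2.1 * p.2.2) * a +
      (4 * p.2.1 * (p.1 ^ 2 + p.2.1 ^ 2) + 16 * p.1 * p.2.2) * b = 0) :
    gauge4 (hMul p (s • (a, b, (0 : ℝ)))) ≤ gauge4 p + 8 * s ^ 2 * (gauge4 p + 1) + 3 * s ^ 4 := by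
  obtain ⟨x, y, z⟩ := p
  simp only at horth
  simp only [gauge4, hMul, Prod.smul_mk, smul_eq_mul]
  set c := x * a + y * b with hc
  set w := (x * b - y * a) / 2 with hw
  have hcw : c ^ 2 + 4 * w ^ 2 = x ^ 2 + y ^ 2 := by
    have : c ^ 2 + 4 * w ^ 2 = (x ^ 2 + y ^ 2) * (a ^ 2 + b ^ 2) := by rw [hc, hw]; ring
    rw [this, hab, mul_one]
  have hlin : 4 * (x ^ 2 + y ^ 2) * c + 32 * z * w = 0 := by
    rw [hc, hw]; linarith
  have e1 : (x + s * a) ^ 2 + (y + s * b) ^ 2 = x ^ 2 + y ^ 2 + 2 * s * c + s ^ 2 := by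
    rw [hc]; linear_combination s ^ 2 * hab
  have e2 : z + s * 0 + (x * (s * b) - s * a * y) / 2 = z + s * w := by rw [hw]; ring
  rw [e1, e2]
  set ρ := x ^ 2 + y ^ 2 with hρ
  have hρ0 : 0 ≤ ρ := by positivity
  have e3 : (ρ + 2 * s * c + s ^ 2) ^ 2 + 16 * (z + s * w) ^ 2 =
      ρ ^ 2 + 16 * z ^ 2 + 6 * s ^ 2 * ρ + s ^ 2 * (4 * (s * c)) + s ^ 4 := by
    linear_combination s * hlin + 4 * s ^ 2 * hcw
  rw [e3]
  have hc2 : c ^ 2 ≤ ρ := by nlinarith [sq_nonneg w]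
  have h1 : 4 * (s * c) ≤ 2 * ρ + 2 * s ^ 2 := by nlinarith [sq_nonneg (s - c)]
  have h2 := mul_le_mul_of_nonneg_left h1 (sq_nonneg s)
  have h3 : ρ ≤ ρ ^ 2 + 16 * z ^ 2 + 1 := by nlinarith [sq_nonneg (ρ - 1), sq_nonneg z]
  have h4 := mul_le_mul_of_nonneg_left h3 (sq_nonneg s)
  nlinarith

/-- A discrete sequence with no interior weak local maximum is bounded by its end values. -/
lemma le_max_of_forall_lt_max (g : ℤ → ℝ) (hg : ∀ k, g k < max (g (k + 1)) (g (k - 1)))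
    {m n : ℤ} (hm : m ≤ 0) (hn : 0 ≤ n) : g 0 ≤ max (g m) (g n) := by
  obtain ⟨k, hk, hmax⟩ := Finset.exists_max_image (Finset.Icc m n) g ⟨0, by simp [hm, hn]⟩
  rw [Finset.mem_Icc] at hk
  have h0 := hmax 0 (by simp [hm, hn])
  rcases eq_or_lt_of_le hk.1 with h | h
  · exact h0.trans (h ▸ le_max_left _ _)
  rcases eq_or_lt_of_le hk.2 with h' | h'
  · exact h0.trans (h' ▸ le_max_right _ _)
  have h1 := hmax (k + 1) (by rw [Finset.mem_Icc]; omega)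
  have h2 := hmax (k - 1) (by rw [Finset.mem_Icc]; omega)
  exact absurd (hg k) (not_lt.2 (max_le h1 h2))

lemma le_add_of_second_deriv_le {γ γ' γ'' : ℝ → ℝ} {c s : ℝ} (hs : 0 ≤ s)
    (h1 : ∀ x, HasDerivAt γ (γ' x) x) (h2 : ∀ x, HasDerivAt γ' (γ'' x) x) (h0 : γ' 0 = 0)
    (hc : ∀ x ∈ Set.Icc 0 s, γ'' x ≤ c) : γ s ≤ γ 0 + c * s ^ 2 / 2 := by
  have d1 : ∀ x, HasDerivAt (fun x => γ' x - c * x) (γ'' x - c * 1) x := fun x =>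
    (h2 x).sub ((hasDerivAt_id x).const_mul c)
  have d2 : ∀ x, HasDerivAt (fun x => γ x - c * x ^ 2 / 2) (γ' x - c * x) x := fun x => by
    refine ((h1 x).sub (((hasDerivAt_pow 2 x).const_mul c).div_const 2)).congr_deriv ?_
    push_cast
    ring
  have a1 : AntitoneOn (fun x => γ' x - c * x) (Set.Icc 0 s) := by
    refine antitoneOn_of_deriv_nonpos (convex_Icc 0 s)
      (fun x _ => (d1 x).continuousAt.continuousWithinAt)
      (fun x _ => (d1 x).differentiableAt.differentiableWithinAt) fun x hx => ?_
    rw [(d1 x).deriv]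
    linarith [hc x (interior_subset hx)]
  have a2 : AntitoneOn (fun x => γ x - c * x ^ 2 / 2) (Set.Icc 0 s) := by
    refine antitoneOn_of_deriv_nonpos (convex_Icc 0 s)
      (fun x _ => (d2 x).continuousAt.continuousWithinAt)
      (fun x _ => (d2 x).differentiableAt.differentiableWithinAt) fun x hx => ?_
    rw [(d2 x).deriv]
    have := a1 (Set.left_mem_Icc.2 hs) (interior_subset hx) (interior_subset hx).1
    simpa [h0] using this
  have := a2 (Set.left_mem_Icc.2 hs) (Set.right_mem_Icc.2 hs) hs
  simp only at this
  linarith [this]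

/-- The derivative of a function along a horizontal line. -/
lemma hasDerivAt_along {f : Heis → ℝ} (hf : Differentiable ℝ f) (q : Heis) (a b s : ℝ) :
    HasDerivAt (fun s : ℝ => f (hMul q (s • (a, b, (0 : ℝ)))))
      (a * X1 f (hMul q (s • (a, b, (0 : ℝ)))) + b * X2 f (hMul q (s • (a, b, (0 : ℝ))))) s := by
  have hline : HasDerivAt (fun s : ℝ => hMul q (s • (a, b, (0 : ℝ))))
      (a, b, (q.1 * b - q.2.1 * a) / 2) s := by
    have e : (fun s : ℝ => hMul q (s • (a, b, (0 : ℝ)))) =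
        fun s : ℝ => q + s • ((a, b, (q.1 * b - q.2.1 * a) / 2) : Heis) := by
      funext s
      simp only [hMul, Prod.smul_mk, smul_eq_mul]
      ext <;> simp
      ring
    rw [e]
    simpa using ((hasDerivAt_id s).smul_const
      ((a, b, (q.1 * b - q.2.1 * a) / 2) : Heis)).const_add q
  have h := (hf (hMul q (s • (a, b, (0 : ℝ))))).hasFDerivAt.comp_hasDerivAt s hline
  refine h.congr_deriv ?_
  have e : ((a, b, (q.1 * b - q.2.1 * a) / 2) : Heis) =
      a • ((1, 0, 0) : Heis) + b • ((0, 1, 0) : Heis) +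
        ((q.1 * b - q.2.1 * a) / 2) • ((0, 0, 1) : Heis) := by
    simp
  rw [e, map_add, map_add, map_smul, map_smul, map_smul]
  simp only [X1, X2, hMul, Prod.smul_mk, smul_eq_mul]
  ring

lemma contDiff_X1 {f : Heis → ℝ} (hf : ContDiff ℝ (⊤ : ℕ∞) f) : ContDiff ℝ (⊤ : ℕ∞) (X1 f) := by
  have h : ContDiff ℝ (⊤ : ℕ∞) (fderiv ℝ f) := hf.fderiv_right (by simp)
  unfold X1
  fun_prop

lemma contDiff_X2 {f : Heis → ℝ} (hf : ContDiff ℝ (⊤ : ℕ∞) f) : ContDiff ℝ (⊤ : ℕ∞) (X2 f) := by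
  have h : ContDiff ℝ (⊤ : ℕ∞) (fderiv ℝ f) := hf.fderiv_right (by simp)
  unfold X2
  fun_prop

lemma continuous_hessH {f : Heis → ℝ} (hf : ContDiff ℝ (⊤ : ℕ∞) f) : Continuous (hessH f) := by
  have h11 := (contDiff_X1 (contDiff_X1 hf)).continuous
  have h12 := (contDiff_X1 (contDiff_X2 hf)).continuous
  have h21 := (contDiff_X2 (contDiff_X1 hf)).continuous
  have h22 := (contDiff_X2 (contDiff_X2 hf)).continuous
  unfold hessH
  fun_prop

/-- Second-order Taylor upper bound along a horizontal line orthogonal to the horizontal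
gradient. -/
lemma taylor_along {f : Heis → ℝ} (hf : ContDiff ℝ (⊤ : ℕ∞) f) (q : Heis) {a b c s : ℝ}
    (hs : 0 ≤ s) (horth : a * X1 f q + b * X2 f q = 0)
    (hc : ∀ x ∈ Set.Icc 0 s, (hessH f (hMul q (x • (a, b, (0 : ℝ))))).1 * a ^ 2 +
      2 * (hessH f (hMul q (x • (a, b, (0 : ℝ))))).2.1 * a * b +
      (hessH f (hMul q (x • (a, b, (0 : ℝ))))).2.2 * b ^ 2 ≤ c) :
    f (hMul q (s • (a, b, (0 : ℝ)))) ≤ f q + c * s ^ 2 / 2 := by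
  have h := le_add_of_second_deriv_le hs
    (fun x => hasDerivAt_along (hf.differentiable (by simp)) q a b x)
    (fun x => ((hasDerivAt_along ((contDiff_X1 hf).differentiable (by simp)) q a b x).const_mul
      a).add ((hasDerivAt_along ((contDiff_X2 hf).differentiable (by simp)) q a b x).const_mul b))
    (by rw [zero_smul, hMul_zero]; exact horth)
    (c := c) (fun x hx => le_trans (le_of_eq (by simp only [hessH]; ring)) (hc x hx))
  rwa [zero_smul, hMul_zero] at h

lemma quad_abs_le (A : ℝ × ℝ × ℝ) (a b : ℝ) (hab : a ^ 2 + b ^ 2 = 1) :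
    |A.1 * a ^ 2 + 2 * A.2.1 * a * b + A.2.2 * b ^ 2| ≤ 4 * ‖A‖ := by
  have n1 : |A.1| ≤ ‖A‖ := norm_fst_le A
  have n2 : |A.2.1| ≤ ‖A‖ := (norm_fst_le A.2).trans (norm_snd_le A)
  have n3 : |A.2.2| ≤ ‖A‖ := (norm_snd_le A.2).trans (norm_snd_le A)
  have h1 : |A.1 * a ^ 2| ≤ ‖A‖ * 1 := by
    rw [abs_mul]
    exact mul_le_mul n1 (by rw [abs_of_nonneg (sq_nonneg a)]; nlinarith [sq_nonneg b])
      (abs_nonneg _) (norm_nonneg _)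
  have h3 : |A.2.2 * b ^ 2| ≤ ‖A‖ * 1 := by
    rw [abs_mul]
    exact mul_le_mul n3 (by rw [abs_of_nonneg (sq_nonneg b)]; nlinarith [sq_nonneg a])
      (abs_nonneg _) (norm_nonneg _)
  have h2 : |2 * A.2.1 * a * b| ≤ ‖A‖ * 1 := by
    rw [show 2 * A.2.1 * a * b = A.2.1 * (2 * a * b) by ring, abs_mul]
    refine mul_le_mul n2 (abs_le.2 ⟨?_, ?_⟩) (abs_nonneg _) (norm_nonneg _)
    · nlinarith [sq_nonneg (a + b)]
    · nlinarith [sq_nonneg (a - b)]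
  have := abs_add_three (A.1 * a ^ 2) (2 * A.2.1 * a * b) (A.2.2 * b ^ 2)
  linarith [norm_nonneg A]

lemma L0H_le (ξ : ℝ × ℝ) (A : ℝ × ℝ × ℝ) : L0H ξ A ≤ 4 * ‖A‖ := by
  obtain ⟨η, h1, h2⟩ := exists_unit_orthogonal ξ
  have hb : BddBelow {m : ℝ | ∃ η : ℝ × ℝ, η.1 ^ 2 + η.2 ^ 2 = 1 ∧ ξ.1 * η.1 + ξ.2 * η.2 = 0 ∧
      m = A.1 * η.1 ^ 2 + 2 * A.2.1 * η.1 * η.2 + A.2.2 * η.2 ^ 2} := by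
    refine ⟨-(4 * ‖A‖), ?_⟩
    rintro m ⟨η, h1, -, rfl⟩
    exact (abs_le.1 (quad_abs_le A _ _ h1)).1
  exact (csInf_le hb ⟨η, h1, h2, rfl⟩).trans (abs_le.1 (quad_abs_le A _ _ h1)).2

lemma exists_of_L0H_lt {ξ : ℝ × ℝ} {A : ℝ × ℝ × ℝ} {a : ℝ} (h : L0H ξ A < a) :
    ∃ η : ℝ × ℝ, η.1 ^ 2 + η.2 ^ 2 = 1 ∧ ξ.1 * η.1 + ξ.2 * η.2 = 0 ∧
      A.1 * η.1 ^ 2 + 2 * A.2.1 * η.1 * η.2 + A.2.2 * η.2 ^ 2 < a := by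
  obtain ⟨η₀, h1, h2⟩ := exists_unit_orthogonal ξ
  obtain ⟨m, ⟨η, h3, h4, rfl⟩, hm⟩ := exists_lt_of_csInf_lt (by exact ⟨_, η₀, h1, h2, rfl⟩) h
  exact ⟨η, h3, h4, hm⟩

/-- The game values `u ε` satisfy the initial condition and the dynamic programming principle. -/
structure IsGameValue (u₀ : Heis → ℝ) (u : ℝ → Heis → ℝ → ℝ) : Prop where
  init : ∀ ε : ℝ, 0 < ε → ∀ p : Heis, ∀ t : ℝ, 0 ≤ t → t < ε ^ 2 → u ε p t = u₀ p
  dpp : ∀ ε : ℝ, 0 < ε → ∀ p : Heis, ∀ t : ℝ, ε ^ 2 ≤ t →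
    IsLeast {m : ℝ | ∃ v ∈ horiz, v.1 ^ 2 + v.2.1 ^ 2 = 1 ∧
      m = max (u ε (hMul p ((Real.sqrt 2 * ε) • v)) (t - ε ^ 2))
              (u ε (hMul p (-((Real.sqrt 2 * ε) • v))) (t - ε ^ 2))} (u ε p t)

/-- Induction on time in steps of size `ε ^ 2`. -/
lemma time_induction {ε : ℝ} (hε : 0 < ε) {P : ℝ → Prop}
    (base : ∀ t, 0 ≤ t → t < ε ^ 2 → P t)
    (step : ∀ t, ε ^ 2 ≤ t → P (t - ε ^ 2) → P t) (t : ℝ) (ht : 0 ≤ t) : P t := by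
  have hε2 : 0 < ε ^ 2 := by positivity
  have main : ∀ n : ℕ, ∀ t, 0 ≤ t → t < (n + 1) * ε ^ 2 → P t := by
    intro n
    induction n with
    | zero => intro t h0 h1; exact base t h0 (by simpa using h1)
    | succ n ih =>
      intro t h0 h1
      rcases lt_or_ge t (ε ^ 2) with h | h
      · exact base t h0 h
      · refine step t h (ih _ (by linarith) ?_)
        push_cast at h1
        linarith
  obtain ⟨n, hn⟩ := exists_nat_gt (t / ε ^ 2)
  rw [div_lt_iff₀ hε2] at hn
  exact main n t ht (by linarith)

section Game

variable {u₀ : Heis → ℝ} {u : ℝ → Heis → ℝ → ℝ}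

/-- Uniform h-quasiconvexity of the terminal cost makes the game value increase in time. -/
lemma IsGameValue.add_le (hu : IsGameValue u₀ u) {r₀ lam : ℝ}
    (huqc : UniformlyHQuasiconvexOn u₀ Set.univ r₀ lam) {ε : ℝ} (hε : 0 < ε) (hεr : √2 * ε < r₀)
    {t : ℝ} (ht : 0 ≤ t) : ∀ p, u ε p t + 2 * lam * ε ^ 2 ≤ u ε p (t + ε ^ 2) := by
  have hs : 0 < √2 * ε := by positivity
  have hs2 : (√2 * ε) ^ 2 = 2 * ε ^ 2 := by rw [mul_pow, Real.sq_sqrt (by norm_num)]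
  refine time_induction hε (P := fun t => ∀ p, u ε p t + 2 * lam * ε ^ 2 ≤ u ε p (t + ε ^ 2))
    ?_ ?_ t ht
  · intro t h0 h1 p
    obtain ⟨v, hv, hv1, he⟩ := (hu.dpp ε hε p (t + ε ^ 2) (by linarith)).1
    rw [add_sub_cancel_right, hu.init ε hε _ t h0 h1, hu.init ε hε _ t h0 h1] at he
    rw [he, hu.init ε hε _ t h0 h1]
    have := huqc _ hs hεr p trivial v hv hv1 trivial trivial
    rw [hs2] at this
    linarith
  · intro t h0 ih p
    obtain ⟨v, hv, hv1, he⟩ := (hu.dpp ε hε p (t + ε ^ 2) (by nlinarith)).1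
    rw [add_sub_cancel_right] at he
    have h := (hu.dpp ε hε p t h0).2 ⟨v, hv, hv1, rfl⟩
    have i1 := ih (hMul p ((√2 * ε) • v))
    have i2 := ih (hMul p (-((√2 * ε) • v)))
    rw [sub_add_cancel] at i1 i2
    rw [he]
    rcases le_max_iff.1 h with h | h
    · exact le_max_of_le_left (by linarith)
    · exact le_max_of_le_right (by linarith)

/-- At a fixed time the game value is uniformly h-quasiconvex at the scale of one step. -/
lemma IsGameValue.add_le_max (hu : IsGameValue u₀ u) {r₀ lam : ℝ}
    (huqc : UniformlyHQuasiconvexOn u₀ Set.univ r₀ lam) {ε : ℝ} (hε : 0 < ε) (hεr : √2 * ε < r₀)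
    {t : ℝ} (ht : 0 ≤ t) (p : Heis) {v : Heis} (hv : v ∈ horiz) (hv1 : v.1 ^ 2 + v.2.1 ^ 2 = 1) :
    u ε p t + 2 * lam * ε ^ 2 ≤
      max (u ε (hMul p ((√2 * ε) • v)) t) (u ε (hMul p (-((√2 * ε) • v))) t) := by
  refine (hu.add_le huqc hε hεr ht p).trans ?_
  refine (hu.dpp ε hε p (t + ε ^ 2) (by linarith)).2 ⟨v, hv, hv1, ?_⟩
  rw [add_sub_cancel_right]

lemma IsGameValue.terminal_le (hu : IsGameValue u₀ u) {r₀ lam : ℝ} (hlam : 0 < lam)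
    (huqc : UniformlyHQuasiconvexOn u₀ Set.univ r₀ lam) {ε : ℝ} (hε : 0 < ε) (hεr : √2 * ε < r₀)
    {t : ℝ} (ht : 0 ≤ t) (p : Heis) : u₀ p ≤ u ε p t := by
  refine time_induction hε (P := fun t => u₀ p ≤ u ε p t) ?_ ?_ t ht
  · intro t h0 h1
    rw [hu.init ε hε p t h0 h1]
  · intro t h0 ih
    have h := hu.add_le huqc hε hεr (t := t - ε ^ 2) (by linarith) p
    rw [sub_add_cancel] at h
    nlinarith [mul_pos hlam (pow_pos hε 2)]

/-- The quartic growth bound is preserved by the game on bounded time intervals. -/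
lemma IsGameValue.le_growth (hu : IsGameValue u₀ u) {L : ℝ} (hL : 0 < L)
    (hgrowth : ∀ p : Heis, u₀ p ≤ L * (gaugeK p ^ 4 + 1)) {t : ℝ} (ht : 0 ≤ t) :
    ∃ M : ℝ, 0 < M ∧ ∀ ε : ℝ, 0 < ε → ∀ p, u ε p t ≤ M * (gauge4 p + 1) := by
  set K := 16 + 12 * t with hK
  have hK0 : 0 ≤ K := by positivity
  refine ⟨L * Real.exp (K * t), by positivity, fun ε hε => ?_⟩
  refine time_induction hε
    (P := fun τ => τ ≤ t → ∀ p, u ε p τ ≤ L * Real.exp (K * τ) * (gauge4 p + 1))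
    ?_ ?_ t ht le_rfl
  · intro τ h0 h1 _ p
    rw [hu.init ε hε p τ h0 h1]
    have h := hgrowth p
    rw [gaugeK_pow_four] at h
    have he : 1 ≤ Real.exp (K * τ) := Real.one_le_exp (by positivity)
    have hp : 0 ≤ L * (gauge4 p + 1) := by have := gauge4_nonneg p; positivity
    nlinarith
  · intro τ h0 ih hτ p
    have hs2 : (√2 * ε) ^ 2 = 2 * ε ^ 2 := by rw [mul_pow, Real.sq_sqrt (by norm_num)]
    have hs4 : (√2 * ε) ^ 4 = 4 * (ε ^ 2 * ε ^ 2) := by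
      rw [show (√2 * ε) ^ 4 = ((√2 * ε) ^ 2) ^ 2 by ring, hs2]; ring
    obtain ⟨⟨a, b⟩, hab, horth⟩ := exists_unit_orthogonal
      (4 * p.1 * (p.1 ^ 2 + p.2.1 ^ 2) - 16 * p.2.1 * p.2.2,
        4 * p.2.1 * (p.1 ^ 2 + p.2.1 ^ 2) + 16 * p.1 * p.2.2)
    simp only at hab horth
    have hG := gauge4_nonneg p
    have hε2 : 0 < ε ^ 2 := by positivity
    have bound : ∀ s : ℝ, s ^ 2 = (√2 * ε) ^ 2 → s ^ 4 = (√2 * ε) ^ 4 →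
        u ε (hMul p (s • (a, b, (0 : ℝ)))) (τ - ε ^ 2) ≤
          L * Real.exp (K * τ) * (gauge4 p + 1) := by
      intro s h2 h4
      have g := gauge4_hMul_le p a b s hab horth
      rw [h2, h4, hs2, hs4] at g
      have g' : gauge4 (hMul p (s • (a, b, (0 : ℝ)))) + 1 ≤ (K * ε ^ 2 + 1) * (gauge4 p + 1) := by
        have : ε ^ 2 * ε ^ 2 ≤ t * ε ^ 2 * (gauge4 p + 1) := by
          have h5 : ε ^ 2 * ε ^ 2 ≤ t * ε ^ 2 := by nlinarith
          have h6 : 0 ≤ t * ε ^ 2 * gauge4 p := by positivity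
          linarith
        rw [hK]
        nlinarith
      refine (ih (by linarith) _).trans ?_
      have he : Real.exp (K * τ) = Real.exp (K * (τ - ε ^ 2)) * Real.exp (K * ε ^ 2) := by
        rw [← Real.exp_add]; ring_nf
      rw [he, mul_assoc L, mul_assoc L, mul_assoc (Real.exp _)]
      gcongr
      exact g'.trans (by gcongr; exact Real.add_one_le_exp _)
    refine ((hu.dpp ε hε p τ h0).2 ⟨(a, b, 0), rfl, hab, rfl⟩).trans (max_le ?_ ?_)
    · exact bound _ rfl rfl
    · rw [← neg_smul]
      exact bound _ (by ring) (by ring)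

/-- Discrete h-quasiconvexity of the game value along a horizontal line. -/
lemma IsGameValue.le_max_along (hu : IsGameValue u₀ u) {r₀ lam : ℝ} (hlam : 0 < lam)
    (huqc : UniformlyHQuasiconvexOn u₀ Set.univ r₀ lam) {ε : ℝ} (hε : 0 < ε) (hεr : √2 * ε < r₀)
    {t : ℝ} (ht : 0 ≤ t) (p : Heis) {v : Heis} (hv : v ∈ horiz) (hv1 : v.1 ^ 2 + v.2.1 ^ 2 = 1)
    {m n : ℤ} (hm : m ≤ 0) (hn : 0 ≤ n) :
    u ε p t ≤ max (u ε (hMul p ((m * (√2 * ε)) • v)) t) (u ε (hMul p ((n * (√2 * ε)) • v)) t) := by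
  have h := le_max_of_forall_lt_max (fun k : ℤ => u ε (hMul p ((k * (√2 * ε)) • v)) t) ?_ hm hn
  · simpa [hMul_zero] using h
  · intro k
    have h := hu.add_le_max huqc hε hεr ht (hMul p ((k * (√2 * ε)) • v)) hv hv1
    rw [← neg_smul, hMul_smul_smul _ _ hv, hMul_smul_smul _ _ hv] at h
    have e1 : ((k + 1 : ℤ) : ℝ) * (√2 * ε) = k * (√2 * ε) + √2 * ε := by push_cast; ring
    have e2 : ((k - 1 : ℤ) : ℝ) * (√2 * ε) = k * (√2 * ε) + -(√2 * ε) := by push_cast; ring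
    simp only [e1, e2]
    have := mul_pos hlam (pow_pos hε 2)
    linarith

/-- The values entering the relaxed upper limit are bounded above on gauge balls. -/
lemma IsGameValue.bddAbove (hu : IsGameValue u₀ u) {L : ℝ} (hL : 0 < L)
    (hgrowth : ∀ p : Heis, u₀ p ≤ L * (gaugeK p ^ 4 + 1)) {t : ℝ} (ht : 0 ≤ t) (p : Heis) (r : ℝ) :
    BddAbove {a : ℝ | ∃ q : Heis, ∃ ε : ℝ,
      gaugeK (hMul (-p) q) < r ∧ 0 < ε ∧ ε < r ∧ a = u ε q t} := by
  obtain ⟨M, hM, hle⟩ := hu.le_growth hL hgrowth ht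
  obtain ⟨C, hC⟩ := gaugeK_ball_subset r
  have hcont : Continuous fun h : Heis => M * (gauge4 (hMul p h) + 1) :=
    continuous_const.mul ((continuous_gauge4.comp (continuous_const.hMul continuous_id)).add
      continuous_const)
  obtain ⟨B, hB⟩ := (isCompact_closedBall (0 : Heis) C).bddAbove_image hcont.continuousOn
  refine ⟨B, ?_⟩
  rintro a ⟨q, ε, hq, hε, -, rfl⟩
  refine (hle ε hε q).trans (hB ⟨hMul (-p) q, ?_, ?_⟩)
  · simpa using hC _ hq
  · simp only [hMul_neg_cancel_left]

/-- Smallness condition on the step size used for lower bounds. -/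
lemma eventually_step_lt {c : ℝ} (hc : 0 < c) (k : ℝ) : ∀ᶠ ε : ℝ in 𝓝[>] 0, k * ε < c := by
  have h : Tendsto (fun ε : ℝ => k * ε) (𝓝[>] 0) (𝓝 0) := by
    have : Continuous fun ε : ℝ => k * ε := by fun_prop
    simpa using (this.tendsto 0).mono_left nhdsWithin_le_nhds
  exact h.eventually (gt_mem_nhds hc)

lemma IsGameValue.terminal_le_sSup (hu : IsGameValue u₀ u) {r₀ lam : ℝ} (hr₀ : 0 < r₀)
    (hlam : 0 < lam) (huqc : UniformlyHQuasiconvexOn u₀ Set.univ r₀ lam) {L : ℝ} (hL : 0 < L)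
    (hgrowth : ∀ p : Heis, u₀ p ≤ L * (gaugeK p ^ 4 + 1)) {t : ℝ} (ht : 0 ≤ t) (p : Heis)
    {r : ℝ} (hr : 0 < r) : u₀ p ≤ sSup {a : ℝ | ∃ q : Heis, ∃ ε : ℝ,
      gaugeK (hMul (-p) q) < r ∧ 0 < ε ∧ ε < r ∧ a = u ε q t} := by
  obtain ⟨ε, ⟨h1, h2⟩, hε⟩ := ((eventually_step_lt hr₀ √2).and
    (eventually_step_lt hr 1)).and self_mem_nhdsWithin |>.exists
  refine (hu.terminal_le hlam huqc hε h1 ht p).trans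
    (le_csSup (hu.bddAbove hL hgrowth ht p r) ⟨p, ε, ?_, hε, by simpa using h2, rfl⟩)
  rw [hMul_neg_self, gaugeK_zero]
  exact hr

lemma IsGameValue.terminal_le_relaxUpper (hu : IsGameValue u₀ u) {r₀ lam : ℝ} (hr₀ : 0 < r₀)
    (hlam : 0 < lam) (huqc : UniformlyHQuasiconvexOn u₀ Set.univ r₀ lam) {L : ℝ} (hL : 0 < L)
    (hgrowth : ∀ p : Heis, u₀ p ≤ L * (gaugeK p ^ 4 + 1)) {t : ℝ} (ht : 0 ≤ t) (p : Heis) :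
    u₀ p ≤ relaxUpper u t p :=
  have : Nonempty {r : ℝ // 0 < r} := ⟨⟨1, one_pos⟩⟩
  le_ciInf fun r => hu.terminal_le_sSup hr₀ hlam huqc hL hgrowth ht p r.2

/-- Values strictly above the relaxed upper limit bound the game values locally. -/
lemma IsGameValue.eventually_lt (hu : IsGameValue u₀ u) {L : ℝ} (hL : 0 < L)
    (hgrowth : ∀ p : Heis, u₀ p ≤ L * (gaugeK p ^ 4 + 1)) {t : ℝ} (ht : 0 ≤ t) {p : Heis} {a : ℝ}
    (ha : relaxUpper u t p < a) : ∀ᶠ x : Heis × ℝ in 𝓝 p ×ˢ 𝓝[>] 0, u x.2 x.1 t < a := by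
  have : Nonempty {r : ℝ // 0 < r} := ⟨⟨1, one_pos⟩⟩
  obtain ⟨⟨r, hr⟩, hlt⟩ := exists_lt_of_ciInf_lt ha
  have h1 : ∀ᶠ q in 𝓝 p, gaugeK (hMul (-p) q) < r := by
    have hcont : Continuous fun q => gaugeK (hMul (-p) q) :=
      continuous_gaugeK.comp (continuous_const.hMul continuous_id)
    refine hcont.continuousAt.eventually (gt_mem_nhds ?_)
    simp only
    rw [hMul_neg_self, gaugeK_zero]
    exact hr
  filter_upwards [h1.prod_mk ((eventually_step_lt hr 1).and self_mem_nhdsWithin)]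
    with x ⟨hx1, hx2, hx3⟩
  exact (le_csSup (hu.bddAbove hL hgrowth ht p r)
    ⟨x.1, x.2, hx1, hx3, by simpa using hx2, rfl⟩).trans_lt hlt

/-- A local bound on the game values bounds the relaxed upper limit. -/
lemma IsGameValue.relaxUpper_le (hu : IsGameValue u₀ u) {r₀ lam : ℝ} (hr₀ : 0 < r₀)
    (hlam : 0 < lam) (huqc : UniformlyHQuasiconvexOn u₀ Set.univ r₀ lam) {L : ℝ} (hL : 0 < L)
    (hgrowth : ∀ p : Heis, u₀ p ≤ L * (gaugeK p ^ 4 + 1)) {t : ℝ} (ht : 0 ≤ t) {p : Heis} {a : ℝ}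
    (ha : ∀ᶠ x : Heis × ℝ in 𝓝 p ×ˢ 𝓝[>] 0, u x.2 x.1 t ≤ a) : relaxUpper u t p ≤ a := by
  obtain ⟨P, hP, Q, hQ, hPQ⟩ := Filter.eventually_prod_iff.1 ha
  have hP' : ∀ᶠ h in 𝓝 (0 : Heis), P (hMul p h) := by
    have hcont : Continuous fun h => hMul p h := continuous_const.hMul continuous_id
    have := hcont.tendsto 0
    rw [hMul_zero] at this
    exact this.eventually hP
  obtain ⟨δ, hδ, hball⟩ := Metric.eventually_nhds_iff.1 hP'
  obtain ⟨δ', hδ', hQ'⟩ := mem_nhdsGT_iff_exists_Ioo_subset.1 hQ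
  have hδ'0 : 0 < δ' := hδ'
  have hr : 0 < min 1 (min δ δ') := by positivity
  have hbdd : BddBelow (Set.range fun r : {r : ℝ // 0 < r} => sSup {a : ℝ | ∃ q : Heis, ∃ ε : ℝ,
      gaugeK (hMul (-p) q) < r.1 ∧ 0 < ε ∧ ε < r.1 ∧ a = u ε q t}) := by
    refine ⟨u₀ p, ?_⟩
    rintro _ ⟨r, rfl⟩
    exact hu.terminal_le_sSup hr₀ hlam huqc hL hgrowth ht p r.2
  refine (ciInf_le hbdd ⟨_, hr⟩).trans (csSup_le ?_ ?_)
  · refine ⟨_, p, min 1 (min δ δ') / 2, ?_, by positivity, half_lt_self hr, rfl⟩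
    rw [hMul_neg_self, gaugeK_zero]
    exact hr
  · rintro _ ⟨q, ε, hq, hε, hεr, rfl⟩
    have hn := norm_lt_of_gaugeK_lt (min_le_left _ _) hq
    refine hPQ (x := q) ?_ (y := ε) (hQ' ⟨hε, ?_⟩)
    · have := @hball (hMul (-p) q) ?_
      · rwa [hMul_neg_cancel_left] at this
      · rw [dist_zero_right]
        exact hn.trans_le ((min_le_right _ _).trans (min_le_left _ _))
    · exact hεr.trans_le ((min_le_right _ _).trans (min_le_right _ _))

end Game

section RelaxedLimit

variable {u₀ : Heis → ℝ} {u : ℝ → Heis → ℝ → ℝ}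

lemma IsGameValue.upperSemicontinuous_relaxUpper (hu : IsGameValue u₀ u) {r₀ lam : ℝ}
    (hr₀ : 0 < r₀) (hlam : 0 < lam) (huqc : UniformlyHQuasiconvexOn u₀ Set.univ r₀ lam) {L : ℝ}
    (hL : 0 < L) (hgrowth : ∀ p : Heis, u₀ p ≤ L * (gaugeK p ^ 4 + 1)) {t : ℝ} (ht : 0 ≤ t) :
    UpperSemicontinuous (relaxUpper u t) := by
  intro p a ha
  obtain ⟨b, hb, hba⟩ := exists_between ha
  obtain ⟨P, hP, Q, hQ, hPQ⟩ := Filter.eventually_prod_iff.1 (hu.eventually_lt hL hgrowth ht hb)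
  filter_upwards [hP.eventually_nhds] with q hq
  refine (hu.relaxUpper_le hr₀ hlam huqc hL hgrowth ht ?_).trans_lt hba
  filter_upwards [hq.prod_mk hQ] with x hx
  exact (hPQ hx.1 hx.2).le

lemma IsGameValue.locallyBounded_relaxUpper (hu : IsGameValue u₀ u) (hc : Continuous u₀)
    {r₀ lam : ℝ} (hr₀ : 0 < r₀) (hlam : 0 < lam)
    (huqc : UniformlyHQuasiconvexOn u₀ Set.univ r₀ lam) {L : ℝ} (hL : 0 < L)
    (hgrowth : ∀ p : Heis, u₀ p ≤ L * (gaugeK p ^ 4 + 1)) {t : ℝ} (ht : 0 ≤ t) (p : Heis) :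
    ∃ U ∈ 𝓝 p, ∃ M : ℝ, ∀ q ∈ U, |relaxUpper u t q| ≤ M := by
  have h1 := hu.upperSemicontinuous_relaxUpper hr₀ hlam huqc hL hgrowth ht p
    (relaxUpper u t p + 1) (lt_add_one _)
  have h2 : ∀ᶠ q in 𝓝 p, u₀ p - 1 < u₀ q :=
    hc.continuousAt.eventually (lt_mem_nhds (sub_one_lt _))
  refine ⟨_, h1.and h2, |relaxUpper u t p + 1| + |u₀ p - 1|, fun q hq => abs_le.2 ⟨?_, ?_⟩⟩
  · have := hu.terminal_le_relaxUpper hr₀ hlam huqc hL hgrowth ht q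
    linarith [hq.2, neg_abs_le (u₀ p - 1), abs_nonneg (relaxUpper u t p + 1)]
  · linarith [hq.1, le_abs_self (relaxUpper u t p + 1), abs_nonneg (u₀ p - 1)]

/-- Integer multiples of a vanishing step approximate any real number. -/
lemma tendsto_round_mul_step (s : ℝ) :
    Tendsto (fun ε : ℝ => (round (s / (√2 * ε)) : ℝ) * (√2 * ε)) (𝓝[>] 0) (𝓝 s) := by
  have h0 : Tendsto (fun ε : ℝ => √2 * ε) (𝓝[>] 0) (𝓝 0) := by
    have : Continuous fun ε : ℝ => √2 * ε := by fun_prop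
    simpa using (this.tendsto 0).mono_left nhdsWithin_le_nhds
  rw [tendsto_iff_dist_tendsto_zero]
  refine squeeze_zero' (Eventually.of_forall fun _ => dist_nonneg) ?_ h0
  filter_upwards [self_mem_nhdsWithin] with ε hε
  have hε : 0 < √2 * ε := mul_pos (by positivity) hε
  have h := abs_sub_round (s / (√2 * ε))
  have e : (round (s / (√2 * ε)) : ℝ) * (√2 * ε) - s =
      -((s / (√2 * ε) - round (s / (√2 * ε))) * (√2 * ε)) := by
    rw [sub_mul, div_mul_cancel₀ _ hε.ne']
    ring
  rw [Real.dist_eq, e, abs_neg, abs_mul, abs_of_pos hε]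
  nlinarith

lemma round_div_nonneg {s d : ℝ} (hs : 0 ≤ s) (hd : 0 ≤ d) : 0 ≤ round (s / d) := by
  rw [round_eq]
  exact Int.floor_nonneg.2 (by positivity)

lemma round_div_nonpos {s d : ℝ} (hs : s ≤ 0) (hd : 0 ≤ d) : round (s / d) ≤ 0 := by
  rw [round_eq, ← Int.lt_add_one_iff, Int.floor_lt]
  have := div_nonpos_of_nonpos_of_nonneg hs hd
  push_cast
  linarith

/-- Quasiconvexity of the relaxed upper limit along a unit-speed horizontal line. -/
lemma IsGameValue.relaxUpper_le_max_along (hu : IsGameValue u₀ u) {r₀ lam : ℝ}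
    (hr₀ : 0 < r₀) (hlam : 0 < lam) (huqc : UniformlyHQuasiconvexOn u₀ Set.univ r₀ lam) {L : ℝ}
    (hL : 0 < L) (hgrowth : ∀ p : Heis, u₀ p ≤ L * (gaugeK p ^ 4 + 1)) {t : ℝ} (ht : 0 ≤ t)
    (w : Heis) {v : Heis} (hv : v ∈ horiz) (hv1 : v.1 ^ 2 + v.2.1 ^ 2 = 1) {a b : ℝ} (ha : a ≤ 0)
    (hb : 0 ≤ b) : relaxUpper u t w ≤
      max (relaxUpper u t (hMul w (a • v))) (relaxUpper u t (hMul w (b • v))) := by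
  refine le_of_forall_gt_imp_ge_of_dense fun c hc => ?_
  refine hu.relaxUpper_le hr₀ hlam huqc hL hgrowth ht ?_
  have hT : ∀ s : ℝ, Tendsto
      (fun x : Heis × ℝ => (hMul x.1 (((round (s / (√2 * x.2)) : ℝ) * (√2 * x.2)) • v), x.2))
      (𝓝 w ×ˢ 𝓝[>] 0) (𝓝 (hMul w (s • v)) ×ˢ 𝓝[>] 0) := by
    intro s
    refine Tendsto.prodMk ?_ tendsto_snd
    have hcont : Continuous fun x : Heis × ℝ => hMul x.1 (x.2 • v) :=
      continuous_fst.hMul (continuous_snd.smul continuous_const)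
    have h2 : Tendsto
        (fun x : Heis × ℝ => (x.1, (round (s / (√2 * x.2)) : ℝ) * (√2 * x.2)))
        (𝓝 w ×ˢ 𝓝[>] 0) (𝓝 (w, s)) := by
      exact tendsto_fst.prodMk_nhds ((tendsto_round_mul_step s).comp tendsto_snd)
    exact (hcont.tendsto (w, s)).comp h2
  have hA := (hT a).eventually (hu.eventually_lt hL hgrowth ht ((le_max_left _ _).trans_lt hc))
  have hB := (hT b).eventually (hu.eventually_lt hL hgrowth ht ((le_max_right _ _).trans_lt hc))
  have hstep : ∀ᶠ x : Heis × ℝ in 𝓝 w ×ˢ 𝓝[>] 0, √2 * x.2 < r₀ ∧ 0 < x.2 :=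
    ((eventually_step_lt hr₀ √2).and self_mem_nhdsWithin).prod_inr _
  filter_upwards [hA, hB, hstep] with x hx1 hx2 ⟨hx3, hx4⟩
  have hd : 0 ≤ √2 * x.2 := by positivity
  exact (hu.le_max_along hlam huqc hx4 hx3 ht x.1 hv hv1 (round_div_nonpos ha hd)
    (round_div_nonneg hb hd)).trans (max_le hx1.le hx2.le)

lemma IsGameValue.hQuasiconvexOn_relaxUpper (hu : IsGameValue u₀ u) {r₀ lam : ℝ}
    (hr₀ : 0 < r₀) (hlam : 0 < lam) (huqc : UniformlyHQuasiconvexOn u₀ Set.univ r₀ lam) {L : ℝ}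
    (hL : 0 < L) (hgrowth : ∀ p : Heis, u₀ p ≤ L * (gaugeK p ^ 4 + 1)) {t : ℝ} (ht : 0 ≤ t) :
    HQuasiconvexOn (relaxUpper u t) Set.univ := by
  rintro p - _ - ⟨⟨x, y, z⟩, hz, rfl⟩ w ⟨l, hl0, hl1, hw⟩
  have hz : z = 0 := hz
  subst hz
  by_cases h0 : x ^ 2 + y ^ 2 = 0
  · have hx : x = 0 := by nlinarith [sq_nonneg x, sq_nonneg y]
    have hy : y = 0 := by nlinarith [sq_nonneg x, sq_nonneg y]
    subst hx hy
    have e : hMul p (0, 0, 0) = p := hMul_zero p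
    rw [e, ← add_smul, add_sub_cancel, one_smul] at hw
    rw [hw]
    exact le_max_left _ _
  · have hp : 0 < x ^ 2 + y ^ 2 := lt_of_le_of_ne (by positivity) (Ne.symm h0)
    have hs := Real.sq_sqrt hp.le
    have hs0 := Real.sqrt_pos.2 hp
    set R := √(x ^ 2 + y ^ 2) with hR
    have hv : ((x / R, y / R, 0) : Heis) ∈ horiz := rfl
    have hRv : R • ((x / R, y / R, 0) : Heis) = (x, y, 0) := by
      simp only [Prod.smul_mk, smul_eq_mul, mul_zero]
      rw [mul_div_cancel₀ _ hs0.ne', mul_div_cancel₀ _ hs0.ne']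
    have hw' : w = hMul p (((1 - l) * R) • ((x / R, y / R, 0) : Heis)) := by
      rw [hw, mul_smul, hRv]
      simp only [hMul, Prod.smul_mk, smul_eq_mul]
      ext <;> simp <;> ring
    have h := hu.relaxUpper_le_max_along hr₀ hlam huqc hL hgrowth ht w hv
      (by simp only [div_pow, hs]; field_simp) (a := -((1 - l) * R)) (b := l * R)
      (neg_nonpos.2 (mul_nonneg (by linarith) hs0.le)) (by positivity)
    have e1 : hMul w (-((1 - l) * R) • ((x / R, y / R, 0) : Heis)) = p := by
      rw [hw', hMul_smul_smul _ _ hv, add_neg_cancel, zero_smul, hMul_zero]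
    have e2 : hMul w ((l * R) • ((x / R, y / R, 0) : Heis)) = hMul p (x, y, 0) := by
      rw [hw', hMul_smul_smul _ _ hv, ← hRv]
      congr 2
      ring
    rwa [e1, e2] at h

/-- If the relaxed upper limit minus `φ` is strictly below a level on a compact set, then so are
the game values minus `φ` for small step size. -/
lemma IsGameValue.eventually_lt_on_compact (hu : IsGameValue u₀ u) {L : ℝ} (hL : 0 < L)
    (hgrowth : ∀ p : Heis, u₀ p ≤ L * (gaugeK p ^ 4 + 1)) {t : ℝ} (ht : 0 ≤ t) {φ : Heis → ℝ}
    (hφ : Continuous φ) {S : Set Heis} (hS : IsCompact S) {m : ℝ}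
    (hm : ∀ q ∈ S, relaxUpper u t q - φ q < m) :
    ∃ m₁ < m, ∀ᶠ ε : ℝ in 𝓝[>] 0, ∀ q ∈ S, u ε q t - φ q < m₁ := by
  refine hS.induction_on (p := fun S => ∃ m₁ < m, ∀ᶠ ε : ℝ in 𝓝[>] 0, ∀ q ∈ S,
    u ε q t - φ q < m₁) ⟨m - 1, by linarith, by simp⟩ ?_ ?_ ?_
  · rintro s s' hss ⟨m₁, h1, h2⟩
    exact ⟨m₁, h1, h2.mono fun ε h q hq => h q (hss hq)⟩
  · rintro s s' ⟨m₁, h1, h2⟩ ⟨m₂, h3, h4⟩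
    refine ⟨max m₁ m₂, max_lt h1 h3, ?_⟩
    filter_upwards [h2, h4] with ε hε hε' q hq
    rcases hq with hq | hq
    · exact (hε q hq).trans_le (le_max_left _ _)
    · exact (hε' q hq).trans_le (le_max_right _ _)
  · intro q hq
    have hlt := hm q hq
    set d := (m - (relaxUpper u t q - φ q)) / 4 with hd
    have hd0 : 0 < d := by rw [hd]; linarith
    obtain ⟨P, hP, Q, hQ, hPQ⟩ := Filter.eventually_prod_iff.1
      (hu.eventually_lt hL hgrowth ht (lt_add_of_pos_right (relaxUpper u t q) hd0))
    have hφq : ∀ᶠ q' in 𝓝 q, φ q - d < φ q' :=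
      hφ.continuousAt.eventually (lt_mem_nhds (by linarith))
    refine ⟨_, mem_nhdsWithin_of_mem_nhds (hP.and hφq),
      relaxUpper u t q - φ q + 2 * d, by linarith, ?_⟩
    filter_upwards [hQ] with ε hε q' hq'
    have h1 := hPQ hq'.1 hε
    have h2 := hq'.2
    simp only at h1
    linarith

lemma dist_hMul_le (q : Heis) {a b : ℝ} (hab : a ^ 2 + b ^ 2 = 1) {s : ℝ} (hs : 0 ≤ s) :
    dist (hMul q (s • (a, b, (0 : ℝ)))) q ≤ s * (1 + ‖q‖) := by
  have ha : |a| ≤ 1 := abs_le.2 ⟨by nlinarith [sq_nonneg b], by nlinarith [sq_nonneg b]⟩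
  have hb : |b| ≤ 1 := abs_le.2 ⟨by nlinarith [sq_nonneg a], by nlinarith [sq_nonneg a]⟩
  have n1 : |q.1| ≤ ‖q‖ := norm_fst_le q
  have n2 : |q.2.1| ≤ ‖q‖ := (norm_fst_le q.2).trans (norm_snd_le q)
  have hn := norm_nonneg q
  have e : hMul q (s • (a, b, (0 : ℝ))) - q =
      s • ((a, b, (q.1 * b - a * q.2.1) / 2) : Heis) := by
    simp only [hMul, Prod.smul_mk, smul_eq_mul]
    ext <;> simp
    ring
  rw [dist_eq_norm, e, norm_smul, Real.norm_eq_abs, abs_of_nonneg hs]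
  refine mul_le_mul_of_nonneg_left (max_le ?_ (max_le ?_ ?_)) hs
  · simp only [Real.norm_eq_abs]; linarith
  · simp only [Real.norm_eq_abs]; linarith
  · simp only [Real.norm_eq_abs]
    have h1 : |q.1 * b| ≤ ‖q‖ := by
      rw [abs_mul]; nlinarith [abs_nonneg q.1, abs_nonneg b]
    have h2 : |a * q.2.1| ≤ ‖q‖ := by
      rw [abs_mul]; nlinarith [abs_nonneg q.2.1, abs_nonneg a]
    rw [abs_div, abs_two]
    have := abs_sub (q.1 * b) (a * q.2.1)
    linarith

lemma IsGameValue.subsolution_relaxUpper (hu : IsGameValue u₀ u) {r₀ lam : ℝ}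
    (hr₀ : 0 < r₀) (hlam : 0 < lam) (huqc : UniformlyHQuasiconvexOn u₀ Set.univ r₀ lam) {L : ℝ}
    (hL : 0 < L) (hgrowth : ∀ p : Heis, u₀ p ≤ L * (gaugeK p ^ 4 + 1)) {t : ℝ} (ht : 0 ≤ t)
    {φ : Heis → ℝ} (hφ : ContDiff ℝ (⊤ : ℕ∞) φ) {p : Heis}
    (hp : StrictLocalMaxOnSet (fun q => relaxUpper u t q - φ q) Set.univ p) :
    2 * lam ≤ LbarOp φ p := by
  have hH := continuous_hessH hφ
  have hLbd : ∀ᶠ q in 𝓝 p, Lop φ q ≤ 4 * (‖hessH φ p‖ + 1) := by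
    filter_upwards [hH.norm.continuousAt.eventually (gt_mem_nhds (lt_add_one ‖hessH φ p‖))]
      with q hq
    exact (L0H_le _ _).trans (by linarith)
  rw [LbarOp, Filter.limsup_eq]
  refine le_csInf ⟨_, hLbd⟩ fun a ha => ?_
  by_contra! hlt
  set δ := (2 * lam - a) / 4 with hδ
  have hδ0 : 0 < δ := by rw [hδ]; linarith
  obtain ⟨N, hN, hmax⟩ := hp
  have hHp : ∀ᶠ q in 𝓝 p, dist (hessH φ q) (hessH φ p) < δ / 8 :=
    hH.continuousAt.eventually (Metric.ball_mem_nhds _ (by positivity))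
  obtain ⟨ρ, hρ, hball⟩ := Metric.nhds_basis_closedBall.mem_iff.1
    (Filter.inter_mem (Filter.inter_mem hN ha) hHp)
  have hφc := hφ.continuous
  have hS : IsCompact (Metric.closedBall p ρ \ Metric.ball p (ρ / 2)) :=
    (isCompact_closedBall p ρ).diff Metric.isOpen_ball
  obtain ⟨m₁, hm₁, hshell⟩ := hu.eventually_lt_on_compact hL hgrowth ht hφc hS
    (m := relaxUpper u t p - φ p) (fun q hq => hmax q ⟨(hball hq.1).1.1, trivial⟩ (by
      rintro rfl
      exact hq.2 (Metric.mem_ball_self (by positivity))))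
  have hfreq : ∃ᶠ x : Heis × ℝ in 𝓝 p ×ˢ 𝓝[>] 0, m₁ < u x.2 x.1 t - φ x.1 := by
    intro hev
    set d := (relaxUpper u t p - φ p - m₁) / 2 with hd
    have hd0 : 0 < d := by rw [hd]; linarith
    have hφp : ∀ᶠ x : Heis × ℝ in 𝓝 p ×ˢ 𝓝[>] 0, φ x.1 < φ p + d :=
      (hφc.continuousAt.eventually (gt_mem_nhds (by linarith))).prod_inl _
    have := hu.relaxUpper_le hr₀ hlam huqc hL hgrowth ht (p := p) (a := m₁ + φ p + d) (by
      filter_upwards [hev, hφp] with x h1 h2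
      linarith [not_lt.1 h1])
    linarith
  have hR : 0 < ρ / 2 := by positivity
  have hev : ∀ᶠ x : Heis × ℝ in 𝓝 p ×ˢ 𝓝[>] 0, x.1 ∈ Metric.closedBall p ρ ∧
      (∀ q ∈ Metric.closedBall p ρ \ Metric.ball p (ρ / 2), u x.2 q t - φ q < m₁) ∧
      √2 * x.2 < r₀ ∧ √2 * (1 + (‖p‖ + ρ)) * x.2 < ρ / 2 ∧ 0 < x.2 :=
    Filter.Eventually.prod_mk (Metric.closedBall_mem_nhds p hρ)
      (hshell.and ((eventually_step_lt hr₀ _).and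
        ((eventually_step_lt hR _).and self_mem_nhdsWithin)))
  obtain ⟨⟨q₀, ε⟩, hq₀, hq₀K, hsh, hεr, hερ, hε⟩ := (hfreq.and_eventually hev).exists
  simp only at hq₀ hq₀K hsh hεr hερ hε
  obtain ⟨M, hM, hle⟩ := hu.le_growth hL hgrowth ht
  have hbdd : BddAbove ((fun q => u ε q t - φ q) '' Metric.closedBall p ρ) := by
    have hcont : Continuous fun q : Heis => M * (gauge4 q + 1) - φ q :=
      (continuous_const.mul (continuous_gauge4.add continuous_const)).sub hφc
    obtain ⟨B, hB⟩ := (isCompact_closedBall p ρ).bddAbove_image hcont.continuousOn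
    refine ⟨B, ?_⟩
    rintro _ ⟨q, hq, rfl⟩
    exact (sub_le_sub_right (hle ε hε q) _).trans (hB ⟨q, hq, rfl⟩)
  set s := sSup ((fun q => u ε q t - φ q) '' Metric.closedBall p ρ) with hs
  have hle_s : ∀ q ∈ Metric.closedBall p ρ, u ε q t - φ q ≤ s := fun q hq =>
    le_csSup hbdd ⟨q, hq, rfl⟩
  have hε2 : 0 < ε ^ 2 := by positivity
  have hlt_s : max m₁ (s - δ * ε ^ 2) < s :=
    max_lt (hq₀.trans_le (hle_s q₀ hq₀K)) (by linarith [mul_pos hδ0 hε2])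
  obtain ⟨_, ⟨q, hqK, rfl⟩, hq⟩ := exists_lt_of_lt_csSup (Set.Nonempty.image _ ⟨q₀, hq₀K⟩) hlt_s
  obtain ⟨hq1, hq2⟩ := max_lt_iff.1 hq
  simp only at hq1 hq2
  have hqball : q ∈ Metric.ball p (ρ / 2) := by
    by_contra h
    exact lt_asymm hq1 (hsh q ⟨hqK, h⟩)
  have hLq : Lop φ q < a + δ := lt_of_le_of_lt (hball hqK).1.2 (by linarith)
  obtain ⟨⟨η₁, η₂⟩, hη, horth, hquad⟩ := exists_of_L0H_lt hLq
  simp only [gradH] at hη horth hquad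
  have hs2 : (√2 * ε) ^ 2 = 2 * ε ^ 2 := by rw [mul_pow, Real.sq_sqrt (by norm_num)]
  have hqn : ‖q‖ ≤ ‖p‖ + ρ := by
    have := norm_le_norm_add_norm_sub' q p
    rw [← dist_eq_norm] at this
    linarith [Metric.mem_closedBall.1 hqK]
  have hin : ∀ x ∈ Set.Icc 0 (√2 * ε), ∀ c d : ℝ, c ^ 2 + d ^ 2 = 1 →
      hMul q (x • (c, d, (0 : ℝ))) ∈ Metric.closedBall p ρ := by
    intro x hx c d hcd
    have h1 := dist_hMul_le q hcd hx.1
    have h2 : x * (1 + ‖q‖) ≤ √2 * ε * (1 + (‖p‖ + ρ)) :=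
      mul_le_mul hx.2 (by linarith) (by positivity) (by positivity)
    have h3 := dist_triangle (hMul q (x • (c, d, (0 : ℝ)))) q p
    rw [Metric.mem_closedBall]
    linarith [Metric.mem_ball.1 hqball]
  have hstep : ∀ c d : ℝ, c ^ 2 + d ^ 2 = 1 → c * X1 φ q + d * X2 φ q = 0 →
      (hessH φ q).1 * c ^ 2 + 2 * (hessH φ q).2.1 * c * d + (hessH φ q).2.2 * d ^ 2 < a + δ →
      u ε (hMul q ((√2 * ε) • (c, d, (0 : ℝ)))) t < u ε q t + 2 * lam * ε ^ 2 := by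
    intro c d hcd ho hqd
    have hsε : 0 ≤ √2 * ε := by positivity
    have htay := taylor_along hφ q (c := a + 2 * δ) hsε ho (fun x hx => by
      have h1 := (hball (hin x hx c d hcd)).2
      have h2 := (hball hqK).2
      have h3 := quad_abs_le (hessH φ (hMul q (x • (c, d, (0 : ℝ)))) - hessH φ q) c d hcd
      have h4 : ‖hessH φ (hMul q (x • (c, d, (0 : ℝ)))) - hessH φ q‖ ≤ δ / 8 + δ / 8 := by
        rw [← dist_eq_norm]
        exact (dist_triangle_right _ _ (hessH φ p)).trans (add_le_add h1.le h2.le)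
      have h5 := (abs_le.1 h3).2
      simp only [Prod.fst_sub, Prod.snd_sub] at h5
      linarith)
    have h6 := hle_s _ (hin _ ⟨hsε, le_rfl⟩ c d hcd)
    rw [hs2] at htay
    have h7 : (a + 2 * δ) * (2 * ε ^ 2) / 2 + δ * ε ^ 2 < 2 * lam * ε ^ 2 := by
      have : a + 3 * δ < 2 * lam := by linarith
      nlinarith
    linarith
  have hgame := hu.add_le_max huqc hε hεr ht q (v := (η₁, η₂, 0)) rfl hη
  refine absurd hgame (not_le.2 (max_lt ?_ ?_))
  · exact hstep η₁ η₂ hη (by linarith) hquad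
  · have e : -((√2 * ε) • ((η₁, η₂, 0) : Heis)) = (√2 * ε) • ((-η₁, -η₂, 0) : Heis) := by
      simp
    rw [e]
    exact hstep (-η₁) (-η₂) (by linarith) (by linarith) (by linarith)

end RelaxedLimit

theorem statement11 (u₀ : Heis → ℝ) (hc : Continuous u₀)
    (r₀ lam : ℝ) (hr₀ : 0 < r₀) (hlam : 0 < lam)
    (huqc : UniformlyHQuasiconvexOn u₀ Set.univ r₀ lam)
    (L : ℝ) (hL : 0 < L) (hgrowth : ∀ p : Heis, u₀ p ≤ L * (gaugeK p ^ 4 + 1))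
    (u : ℝ → Heis → ℝ → ℝ)
    (hinit : ∀ ε : ℝ, 0 < ε → ∀ p : Heis, ∀ t : ℝ, 0 ≤ t → t < ε ^ 2 → u ε p t = u₀ p)
    (hdpp : ∀ ε : ℝ, 0 < ε → ∀ p : Heis, ∀ t : ℝ, ε ^ 2 ≤ t →
      IsLeast {m : ℝ | ∃ v ∈ horiz, v.1 ^ 2 + v.2.1 ^ 2 = 1 ∧
        m = max (u ε (hMul p ((Real.sqrt 2 * ε) • v)) (t - ε ^ 2))
                (u ε (hMul p (-((Real.sqrt 2 * ε) • v))) (t - ε ^ 2))} (u ε p t))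
    (t : ℝ) (ht : 0 < t) :
    UpperSemicontinuous (relaxUpper u t) ∧
    (∀ p : Heis, ∃ U ∈ 𝓝 p, ∃ M : ℝ, ∀ q ∈ U, |relaxUpper u t q| ≤ M) ∧
    (∀ φ : Heis → ℝ, ContDiff ℝ (⊤ : ℕ∞) φ → ∀ p : Heis,
      StrictLocalMaxOnSet (fun q => relaxUpper u t q - φ q) Set.univ p →
        2 * lam ≤ LbarOp φ p) ∧
    HQuasiconvexOn (relaxUpper u t) Set.univ := by
  have hu : IsGameValue u₀ u := ⟨hinit, hdpp⟩
  exact ⟨hu.upperSemicontinuous_relaxUpper hr₀ hlam huqc hL hgrowth ht.le,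
    hu.locallyBounded_relaxUpper hc hr₀ hlam huqc hL hgrowth ht.le,
    fun φ hφ p hp => hu.subsolution_relaxUpper hr₀ hlam huqc hL hgrowth ht.le hφ hp,
    hu.hQuasiconvexOn_relaxUpper hr₀ hlam huqc hL hgrowth ht.le⟩
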